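/- arXiv:1901.08166 — 4 statements merged into one kernel-verified Lean document; each statement's English description precedes it below -/
import Mathlib

section
/- Let n ≥ 1 and d ≥ 1 be integers and let A ∈ U_n^d, i.e., every row and every column of A has exactly d nonzero entries. Then there exists a set I ⊆ {1,…,n} with |I| ≥ ⌊n/d²⌋ such that the supports of the columns A_i, i ∈ I, are pairwise disjoint: supp(A_i) ∩ supp(A_j) = ∅ for all distinct i, j ∈ I. -/
open scoped Classical

/-- Support of the `j`-th column of `A`: the set of row indices with a nonzero entry. -/
noncomputable def colSupp {n : ℕ} (A : Matrix (Fin n) (Fin n) ℝ) (j : Fin n) :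
    Finset (Fin n) :=
  Finset.univ.filter fun i => A i j ≠ 0

/-- If every point lies in at most `d` of the sets `s j`, each of which is nonempty of size at
most `d`, then a maximal pairwise disjoint subfamily has at least `|ι| / d ^ 2` members. -/
theorem exists_pairwiseDisjoint_card_le_mul_sq {ι α : Type*} [Fintype ι] (s : ι → Finset α)
    (d : ℕ) (hne : ∀ j, (s j).Nonempty) (hcard : ∀ j, (s j).card ≤ d)
    (hdeg : ∀ a, (Finset.univ.filter fun j => a ∈ s j).card ≤ d) :
    ∃ I : Finset ι, Fintype.card ι ≤ I.card * d ^ 2 ∧ (I : Set ι).PairwiseDisjoint s := by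
  obtain ⟨I, hI⟩ := (Set.toFinite {I : Finset ι | (I : Set ι).PairwiseDisjoint s}).exists_maximal
    ⟨∅, by simp⟩
  refine ⟨I, ?_, hI.prop⟩
  have hcover : (Finset.univ : Finset ι) ⊆
      I.biUnion fun i => (s i).biUnion fun a => Finset.univ.filter fun j => a ∈ s j := by
    intro j _
    simp only [Finset.mem_biUnion, Finset.mem_filter, Finset.mem_univ, true_and]
    by_contra! h
    have hdisj : ∀ i ∈ I, Disjoint (s j) (s i) := fun i hi =>
      Finset.disjoint_right.2 (h i hi)
    have hins : ((insert j I : Finset ι) : Set ι).PairwiseDisjoint s := by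
      rw [Finset.coe_insert]
      exact hI.prop.insert fun i hi _ => hdisj i hi
    have hj : j ∈ I := hI.le_of_ge hins (Finset.subset_insert j I) (Finset.mem_insert_self j I)
    exact (hne j).ne_empty (disjoint_self.1 (hdisj j hj))
  calc Fintype.card ι ≤ _ := Finset.card_le_card hcover
    _ ≤ I.card * (d * d) := Finset.card_biUnion_le_card_mul _ _ _ fun i _ =>
        (Finset.card_biUnion_le_card_mul _ _ d fun a _ => hdeg a).trans
          (Nat.mul_le_mul_right d (hcard i))
    _ = I.card * d ^ 2 := by rw [sq]

/-- If every row and every column of `A ∈ ℝ^{n×n}` has exactly `d` nonzero entries,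
then there is a set `I` of at least `⌊n/d²⌋` column indices whose column supports
are pairwise disjoint. -/
theorem stmt4 (n d : ℕ) (hn : 1 ≤ n) (hd : 1 ≤ d) (A : Matrix (Fin n) (Fin n) ℝ)
    (hrow : ∀ i, (Finset.univ.filter fun l => A i l ≠ 0).card = d)
    (hcol : ∀ j, (colSupp A j).card = d) :
    ∃ I : Finset (Fin n), n / d ^ 2 ≤ I.card ∧
      ∀ i ∈ I, ∀ j ∈ I, i ≠ j → Disjoint (colSupp A i) (colSupp A j) := by
  obtain ⟨I, hcard, hI⟩ := exists_pairwiseDisjoint_card_le_mul_sq (colSupp A) d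
    (fun j => Finset.card_pos.1 (by rw [hcol]; exact hd)) (fun j => (hcol j).le)
    (fun a => by simpa [colSupp] using (hrow a).le)
  rw [Fintype.card_fin] at hcard
  exact ⟨I, Nat.div_le_of_le_mul (by rwa [mul_comm]), fun i hi j hj hij => hI hi hj hij⟩
end

section
/- Let d divide n, let 1 ≤ d ≤ s ≤ n, and let A^FRC be the d-fractional repetition code matrix. Let S be a uniformly random subset of {1,…,n} of size n−s. Then the decoding failure probability satisfies P(err(A^FRC_S) > 0) ≤ (n/d) · (s/n)^d. -/
open scoped Classical

/-- Recovery error of a matrix `B`: `inf_u ‖Bᵀ u − 1‖²`. -/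
noncomputable def err {R C : Type*} [Fintype R] [Fintype C] (B : Matrix R C ℝ) : ℝ :=
  ⨅ u : R → ℝ, ∑ j : C, (∑ i : R, B i j * u i - 1) ^ 2

/-- The row submatrix `A_S` of `A` consisting of the rows indexed by `S`. -/
def rowSub {n : ℕ} (A : Matrix (Fin n) (Fin n) ℝ) (S : Finset (Fin n)) :
    Matrix {r : Fin n // r ∈ S} (Fin n) ℝ := fun r j => A r.1 j

/-- Probability that a uniformly random subset `S ⊆ {1,…,n}` of size `n - s`
satisfies the predicate `p`. -/
noncomputable def failProb (n s : ℕ) (p : Finset (Fin n) → Prop) : ℝ :=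
  (((Finset.powersetCard (n - s) (Finset.univ : Finset (Fin n))).filter p).card : ℝ) /
    (n.choose (n - s))

/-- The `d`-fractional repetition code matrix. -/
def frc (n d : ℕ) : Matrix (Fin n) (Fin n) ℝ :=
  fun r j => if (j : ℕ) / d = (r : ℕ) % (n / d) then 1 else 0

theorem err_rowSub_frc_nonpos {n d : ℕ} [NeZero n] (hdvd : d ∣ n) (S : Finset (Fin n))
    (hS : ∀ i < n / d, ∃ r ∈ S, (r : ℕ) % (n / d) = i) : err (rowSub (frc n d) S) ≤ 0 := by
  choose! f hfS hf using hS
  refine (ciInf_le ⟨0, ?_⟩ fun r => if r.1 = f ((r.1 : ℕ) % (n / d)) then 1 else 0).trans ?_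
  · rintro _ ⟨u, rfl⟩
    positivity
  · refine le_of_eq (Finset.sum_eq_zero fun j _ => ?_)
    have hj : (j : ℕ) / d < n / d := Nat.div_lt_div_of_lt_of_dvd hdvd j.2
    rw [Finset.sum_eq_single ⟨f (j / d), hfS _ hj⟩]
    · simp [rowSub, frc, hf _ hj]
    · rintro ⟨r, hr⟩ _ hne
      simp only [rowSub, frc, ite_mul, one_mul, zero_mul]
      split_ifs with h₁ h₂
      · exact absurd (Subtype.ext (h₂.trans (congrArg f h₁.symm))) hne
      · rfl
      · rfl
    · simp

theorem le_card_filter_mod_eq {n d i : ℕ} (hdvd : d ∣ n) (hi : i < n / d) :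
    d ≤ (Finset.univ.filter fun r : Fin n => (r : ℕ) % (n / d) = i).card := by
  have hlt (k : Fin d) : i + n / d * k < n := by
    calc i + n / d * k < n / d * (k + 1) := by rw [mul_add]; omega
      _ ≤ n / d * d := Nat.mul_le_mul_left _ k.2
      _ = n := Nat.div_mul_cancel hdvd
  have hcard := Finset.card_le_card_of_injOn (s := Finset.univ)
    (t := Finset.univ.filter fun r : Fin n => (r : ℕ) % (n / d) = i)
    (fun k : Fin d => (⟨i + n / d * k, hlt k⟩ : Fin n))
    (fun k _ => by simp [Nat.mod_eq_of_lt hi])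
    (fun k _ l _ h => by
      have h' := Nat.add_left_cancel (Fin.mk.inj h)
      exact Fin.ext (Nat.eq_of_mul_eq_mul_left (by omega) h'))
  simpa using hcard

theorem card_filter_err_pos_le {n d : ℕ} [NeZero n] (k : ℕ) (hdvd : d ∣ n) :
    ((Finset.powersetCard k (Finset.univ : Finset (Fin n))).filter
      fun S => 0 < err (rowSub (frc n d) S)).card ≤ n / d * (n - d).choose k := by
  let cls (i : ℕ) : Finset (Fin n) := Finset.univ.filter fun r => (r : ℕ) % (n / d) = i
  have hsub : ((Finset.powersetCard k (Finset.univ : Finset (Fin n))).filter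
      fun S => 0 < err (rowSub (frc n d) S)) ⊆
      (Finset.range (n / d)).biUnion fun i => Finset.powersetCard k (cls i)ᶜ := by
    intro S hS
    obtain ⟨hSk, hpos⟩ := Finset.mem_filter.1 hS
    by_contra hmem
    refine hpos.not_ge (err_rowSub_frc_nonpos hdvd S fun i hi => ?_)
    by_contra! hmiss
    refine hmem (Finset.mem_biUnion.2 ⟨i, Finset.mem_range.2 hi, Finset.mem_powersetCard.2
      ⟨fun r hr => ?_, (Finset.mem_powersetCard.1 hSk).2⟩⟩)
    simpa [cls] using hmiss r hr
  refine (Finset.card_le_card hsub).trans ?_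
  refine (Finset.card_biUnion_le_card_mul _ _ ((n - d).choose k) fun i hi => ?_).trans (by simp)
  rw [Finset.card_powersetCard, Finset.card_compl, Fintype.card_fin]
  exact Nat.choose_le_choose _
    (Nat.sub_le_sub_left (le_card_filter_mod_eq hdvd (Finset.mem_range.1 hi)) n)

theorem descFactorial_mul_pow_le {n s : ℕ} (hsn : s ≤ n) (d : ℕ) :
    s.descFactorial d * n ^ d ≤ s ^ d * n.descFactorial d := by
  induction d with
  | zero => simp
  | succ d ih =>
    have hstep : (s - d) * n ≤ s * (n - d) := by
      rw [Nat.sub_mul, Nat.mul_sub]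
      have : s * d ≤ d * n := by rw [mul_comm]; exact Nat.mul_le_mul_left d hsn
      omega
    calc s.descFactorial (d + 1) * n ^ (d + 1)
        = ((s - d) * n) * (s.descFactorial d * n ^ d) := by
          rw [Nat.descFactorial_succ]; ring
      _ ≤ (s * (n - d)) * (s ^ d * n.descFactorial d) := Nat.mul_le_mul hstep ih
      _ = s ^ (d + 1) * n.descFactorial (d + 1) := by
          rw [Nat.descFactorial_succ]; ring

theorem choose_sub_mul_pow_le {n d s : ℕ} (hds : d ≤ s) (hsn : s ≤ n) :
    (n - d).choose (n - s) * n ^ d ≤ s ^ d * n.choose (n - s) := by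
  have hsymm : (n - d).choose (n - s) = (n - d).choose (s - d) :=
    Nat.choose_symm_of_eq_add (by omega)
  rw [hsymm, Nat.choose_symm hsn]
  have hmul : n.choose s * s.choose d = n.choose d * (n - d).choose (s - d) :=
    Nat.choose_mul hds
  have hle := descFactorial_mul_pow_le hsn d
  rw [Nat.descFactorial_eq_factorial_mul_choose, Nat.descFactorial_eq_factorial_mul_choose] at hle
  have hpos : 0 < d.factorial * n.choose d :=
    Nat.mul_pos d.factorial_pos (Nat.choose_pos (hds.trans hsn))
  refine Nat.le_of_mul_le_mul_left ?_ hpos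
  calc d.factorial * n.choose d * ((n - d).choose (s - d) * n ^ d)
      = n.choose s * (d.factorial * s.choose d * n ^ d) := by
        rw [show n.choose s * (d.factorial * s.choose d * n ^ d) =
          n.choose s * s.choose d * (d.factorial * n ^ d) by ring, hmul]
        ring
    _ ≤ n.choose s * (s ^ d * (d.factorial * n.choose d)) := Nat.mul_le_mul_left _ hle
    _ = d.factorial * n.choose d * (s ^ d * n.choose s) := by ring

/-- For the `d`-fractional repetition code with `d ∣ n` and `1 ≤ d ≤ s ≤ n`, the
decoding failure probability is at most `(n/d)(s/n)^d`. -/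
theorem stmt9 (n d s : ℕ) (hdvd : d ∣ n) (hd : 1 ≤ d) (hds : d ≤ s) (hsn : s ≤ n) :
    failProb n s (fun S => 0 < err (rowSub (frc n d) S)) ≤
      ((n : ℝ) / d) * ((s : ℝ) / n) ^ d := by
  have : NeZero n := ⟨by omega⟩
  have hn : (0 : ℝ) < n := by exact_mod_cast (show 0 < n by omega)
  have hchoose : (0 : ℝ) < n.choose (n - s) := by
    exact_mod_cast Nat.choose_pos (Nat.sub_le n s)
  have hcount : (((Finset.powersetCard (n - s) (Finset.univ : Finset (Fin n))).filter
      fun S => 0 < err (rowSub (frc n d) S)).card : ℝ) ≤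
      (n : ℝ) / d * (n - d).choose (n - s) := by
    rw [← Nat.cast_div hdvd (by positivity)]
    exact_mod_cast card_filter_err_pos_le (n - s) hdvd
  have hratio : ((n - d).choose (n - s) : ℝ) ≤ ((s : ℝ) / n) ^ d * n.choose (n - s) := by
    rw [div_pow, div_mul_eq_mul_div, le_div_iff₀ (by positivity)]
    exact_mod_cast choose_sub_mul_pow_le hds hsn
  rw [failProb, div_le_iff₀ hchoose, mul_assoc]
  exact hcount.trans (mul_le_mul_of_nonneg_left hratio (by positivity))
end

section
/- Fix integers n ≥ 1, d ≥ 1 and 0 ≤ s ≤ n, and a real c ≥ 0. Let A ∈ U_n^d, i.e., every row and every column of A has exactly d nonzero entries, and let S be a uniformly random subset of {1,…,n} of size n−s. If P(err(A_S) > c) < 3/4, then ⌊n/d²⌋ · C(n − d, s − d)/C(n, s) < 2c + 4, where C(n − d, s − d) is interpreted as 0 when d > s. -/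
open scoped Classical

/-- Log-concavity of `m ↦ m.choose k`, in the form of a correlation inequality. -/
theorem choose_mul_choose_add_le (k m d e : ℕ) :
    m.choose k * (m + d + e).choose k ≤ (m + e).choose k * (m + d).choose k := by
  induction e with
  | zero => simp
  | succ e ih =>
    by_cases hk : m < k
    · simp [Nat.choose_eq_zero_of_lt hk]
    obtain ⟨t, rfl⟩ : ∃ t, m = k + t := ⟨m - k, by omega⟩
    have h1 := Nat.choose_mul_succ_eq (k + t + d + e) k
    have h2 := Nat.choose_mul_succ_eq (k + t + e) k
    rw [show k + t + d + e + 1 - k = t + d + e + 1 by omega] at h1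
    rw [show k + t + e + 1 - k = t + e + 1 by omega] at h2
    simp only [← Nat.add_assoc]
    refine Nat.le_of_mul_le_mul_left (c := (t + d + e + 1) * (t + e + 1)) ?_ (by positivity)
    calc (t + d + e + 1) * (t + e + 1) *
          ((k + t).choose k * (k + t + d + e + 1).choose k)
        = (k + t).choose k * ((k + t + d + e + 1).choose k * (t + d + e + 1)) *
            (t + e + 1) := by ring
      _ = ((k + t).choose k * (k + t + d + e).choose k) *
            ((k + t + d + e + 1) * (t + e + 1)) := by rw [← h1]; ring
      _ ≤ ((k + t + e).choose k * (k + t + d).choose k) *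
            ((k + t + e + 1) * (t + d + e + 1)) := by
          refine Nat.mul_le_mul ih ?_
          nlinarith [Nat.zero_le (k * d)]
      _ = ((k + t + e).choose k * (k + t + e + 1)) * (k + t + d).choose k *
            (t + d + e + 1) := by ring
      _ = (t + d + e + 1) * (t + e + 1) *
            ((k + t + e + 1).choose k * (k + t + d).choose k) := by rw [h2]; ring

/-- The row indices of the nonzero entries in column `j`. -/
noncomputable def colSupport {n : ℕ} (A : Matrix (Fin n) (Fin n) ℝ) (j : Fin n) :
    Finset (Fin n) := Finset.univ.filter fun i => A i j ≠ 0

theorem exists_pairwise_disjoint_colSupport {n d : ℕ} (hd : 1 ≤ d)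
    (A : Matrix (Fin n) (Fin n) ℝ)
    (hrow : ∀ i, (Finset.univ.filter fun j => A i j ≠ 0).card = d)
    (hcol : ∀ j, (colSupport A j).card = d) (k : ℕ) (hk : k * d ^ 2 ≤ n) :
    ∃ J : Finset (Fin n), J.card = k ∧
      ∀ i ∈ J, ∀ j ∈ J, i ≠ j → Disjoint (colSupport A i) (colSupport A j) := by
  induction k with
  | zero => exact ⟨∅, by simp⟩
  | succ k ih =>
    have hd2 : 0 < d ^ 2 := by positivity
    obtain ⟨J, hJ, hdis⟩ := ih (by nlinarith)
    let M : Finset (Fin n) := J.biUnion fun j =>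
      (colSupport A j).biUnion fun i => Finset.univ.filter fun l => A i l ≠ 0
    have hM : M.card ≤ k * (d * d) := by
      rw [← hJ]
      refine Finset.card_biUnion_le_card_mul _ _ _ fun j _ => ?_
      rw [← hcol j]
      refine Finset.card_biUnion_le_card_mul _ _ _ fun i _ => ?_
      rw [hrow i, hcol j]
    obtain ⟨l, hl⟩ : ∃ l, l ∉ M := by
      by_contra! h
      have : M.card = n := by
        rw [Finset.eq_univ_of_forall h, Finset.card_univ, Fintype.card_fin]
      nlinarith
    have hlM : ∀ j ∈ J, Disjoint (colSupport A j) (colSupport A l) := by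
      intro j hj
      rw [Finset.disjoint_left]
      intro i hi hil
      refine hl (Finset.mem_biUnion.2 ⟨j, hj, Finset.mem_biUnion.2 ⟨i, hi, ?_⟩⟩)
      simpa [colSupport] using hil
    have hlJ : l ∉ J := by
      intro h
      have h0 := hcol l
      rw [(disjoint_self.1 (hlM l h) : colSupport A l = ∅)] at h0
      simp at h0
      omega
    refine ⟨insert l J, by rw [Finset.card_insert_of_notMem hlJ, hJ], ?_⟩
    intro i hi j hj hij
    rcases Finset.mem_insert.1 hi with rfl | hiJ <;>
      rcases Finset.mem_insert.1 hj with rfl | hjJ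
    · exact absurd rfl hij
    · exact (hlM j hjJ).symm
    · exact hlM i hiJ
    · exact hdis i hiJ j hjJ hij

theorem card_filter_disjoint_powersetCard {n k : ℕ} (U : Finset (Fin n)) :
    ((Finset.powersetCard k (Finset.univ : Finset (Fin n))).filter
      fun S => Disjoint U S).card = (n - U.card).choose k := by
  have : (Finset.powersetCard k (Finset.univ : Finset (Fin n))).filter
      (fun S => Disjoint U S) = Finset.powersetCard k Uᶜ := by
    ext S
    simp only [Finset.mem_filter, Finset.mem_powersetCard, Finset.subset_univ, true_and,
      Finset.subset_compl_iff_disjoint_left]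
    tauto
  rw [this, Finset.card_powersetCard, Finset.card_compl, Fintype.card_fin]

/-- Each column whose support avoids `S` contributes `1` to the recovery error of `A_S`. -/
theorem card_filter_disjoint_le_err {n : ℕ} (A : Matrix (Fin n) (Fin n) ℝ)
    (J S : Finset (Fin n)) :
    ((J.filter fun j => Disjoint (colSupport A j) S).card : ℝ) ≤ err (rowSub A S) := by
  refine le_ciInf fun u => ?_
  rw [Finset.card_eq_sum_ones, Nat.cast_sum]
  refine (Finset.sum_le_sum fun j hj => ?_).trans
    (Finset.sum_le_sum_of_subset_of_nonneg (Finset.subset_univ _) fun _ _ _ => sq_nonneg _)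
  have hz : ∀ i : {r : Fin n // r ∈ S}, rowSub A S i j = 0 := by
    intro i
    by_contra h
    exact Finset.disjoint_left.1 (Finset.mem_filter.1 hj).2
      (by simpa [colSupport, rowSub] using h) i.2
  simp [hz]

/-- A second moment bound for sums of pairwise nonpositively correlated indicators. -/
theorem sum_sq_card_filter_le {ι Ω : Type*} (W : Finset Ω) (J : Finset ι) (E : ι → Ω → Prop)
    [∀ j, DecidablePred (E j)]
    (q : ℝ) (hW : 0 < W.card) (h1 : ∀ j ∈ J, ((W.filter (E j)).card : ℝ) = q)
    (h2 : ∀ i ∈ J, ∀ j ∈ J, i ≠ j →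
      ((W.filter fun w => E i w ∧ E j w).card : ℝ) * W.card ≤ q ^ 2) :
    ∑ w ∈ W, (((J.filter fun j => E j w).card : ℝ) - J.card * q / W.card) ^ 2 ≤
      J.card * q := by
  have hN : (0 : ℝ) < W.card := by exact_mod_cast hW
  have hY : ∀ w, ((J.filter fun j => E j w).card : ℝ) = ∑ j ∈ J, if E j w then 1 else 0 := by
    intro w
    simp
  have hS1 : ∑ w ∈ W, ((J.filter fun j => E j w).card : ℝ) = J.card * q := by
    simp_rw [hY]
    rw [Finset.sum_comm, ← nsmul_eq_mul]
    refine Finset.sum_eq_card_nsmul fun j hj => ?_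
    rw [← h1 j hj]
    simp
  have hS2 : ∑ w ∈ W, ((J.filter fun j => E j w).card : ℝ) ^ 2 ≤
      J.card * q + J.card * (J.card * (q ^ 2 / W.card)) := by
    have : ∑ w ∈ W, ((J.filter fun j => E j w).card : ℝ) ^ 2 =
        ∑ i ∈ J, ∑ j ∈ J, ((W.filter fun w => E i w ∧ E j w).card : ℝ) := by
      simp_rw [hY, sq, Finset.sum_mul_sum]
      rw [Finset.sum_comm]
      refine Finset.sum_congr rfl fun i _ => ?_
      rw [Finset.sum_comm]
      refine Finset.sum_congr rfl fun j _ => ?_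
      simp [← ite_and, and_comm]
    rw [this, ← mul_add, ← nsmul_eq_mul]
    refine Finset.sum_le_card_nsmul _ _ _ fun i hi => ?_
    have : ∀ j ∈ J, ((W.filter fun w => E i w ∧ E j w).card : ℝ) ≤
        (if i = j then q else 0) + q ^ 2 / W.card := by
      intro j hj
      split_ifs with hij
      · subst hij
        simp only [and_self, h1 i hi]
        have : 0 ≤ q ^ 2 / W.card := by positivity
        linarith
      · rw [zero_add, le_div_iff₀ hN]
        exact h2 i hi j hj hij
    refine (Finset.sum_le_sum this).trans ?_
    rw [Finset.sum_add_distrib]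
    simp [hi]
  have hexp : ∑ w ∈ W, (((J.filter fun j => E j w).card : ℝ) - J.card * q / W.card) ^ 2 =
      ∑ w ∈ W, ((J.filter fun j => E j w).card : ℝ) ^ 2 -
        2 * (J.card * q / W.card) * ∑ w ∈ W, ((J.filter fun j => E j w).card : ℝ) +
        W.card * (J.card * q / W.card) ^ 2 := by
    simp_rw [sub_sq]
    rw [Finset.sum_add_distrib, Finset.sum_sub_distrib, Finset.mul_sum]
    simp only [Finset.sum_const, nsmul_eq_mul]
    congr 2
    exact Finset.sum_congr rfl fun _ _ => by ring
  rw [hexp, hS1]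
  have e1 : 2 * (J.card * q / W.card) * (J.card * q) =
      2 * ((J.card : ℝ) * (J.card * (q ^ 2 / W.card))) := by ring
  have e2 : (W.card : ℝ) * (J.card * q / W.card) ^ 2 =
      (J.card : ℝ) * (J.card * (q ^ 2 / W.card)) := by
    field_simp
  linarith

/-- If every row and every column of `A` has exactly `d` nonzero entries and the
probability that `err(A_S) > c` is below `3/4`, then
`⌊n/d²⌋ · C(n−d, s−d)/C(n, s) < 2c + 4`, with `C(n−d, s−d)` interpreted as `0`
when `d > s`. -/
theorem stmt14 (n d s : ℕ) (hn : 1 ≤ n) (hd : 1 ≤ d) (hs : s ≤ n) (c : ℝ) (hc : 0 ≤ c)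
    (A : Matrix (Fin n) (Fin n) ℝ)
    (hrow : ∀ i, (Finset.univ.filter fun j => A i j ≠ 0).card = d)
    (hcol : ∀ j, (Finset.univ.filter fun i => A i j ≠ 0).card = d)
    (hfail : failProb n s (fun S => c < err (rowSub A S)) < 3 / 4) :
    ((n / d ^ 2 : ℕ) : ℝ) *
        (if d ≤ s then (((n - d).choose (s - d) : ℕ) : ℝ) else 0) / (n.choose s) <
      2 * c + 4 := by
  change ∀ j, (colSupport A j).card = d at hcol
  by_contra! hcon
  have hds : d ≤ s := by
    by_contra h
    simp only [h, if_false, mul_zero, zero_div] at hcon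
    linarith
  obtain ⟨J, hJ, hdis⟩ := exists_pairwise_disjoint_colSupport hd A hrow hcol (n / d ^ 2)
    (Nat.div_mul_le_self n (d ^ 2))
  set W := Finset.powersetCard (n - s) (Finset.univ : Finset (Fin n)) with hWdef
  have hWc : W.card = n.choose (n - s) := by simp [hWdef]
  have hW : 0 < W.card := hWc ▸ Nat.choose_pos (Nat.sub_le n s)
  have hN : (0 : ℝ) < W.card := by exact_mod_cast hW
  let Y : Finset (Fin n) → ℝ := fun S =>
    ((J.filter fun j => Disjoint (colSupport A j) S).card : ℝ)
  set q : ℝ := (((n - d).choose (n - s) : ℕ) : ℝ) with hq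
  have hvar : ∑ S ∈ W, (Y S - J.card * q / W.card) ^ 2 ≤ J.card * q := by
    refine sum_sq_card_filter_le W J (fun j S => Disjoint (colSupport A j) S) q hW ?_ ?_
    · intro j _
      rw [hWdef, card_filter_disjoint_powersetCard, hcol, hq]
    · intro i hi j hj hij
      have hU : (colSupport A i ∪ colSupport A j).card = d + d := by
        rw [Finset.card_union_of_disjoint (hdis i hi j hj hij), hcol, hcol]
      have hle : d + d ≤ n := by
        rw [← hU]
        simpa using Finset.card_le_univ (colSupport A i ∪ colSupport A j)
      simp only [← Finset.disjoint_union_left]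
      rw [hWc, hWdef, card_filter_disjoint_powersetCard, hU, hq]
      have h := choose_mul_choose_add_le (n - s) (n - (d + d)) d d
      rw [show n - (d + d) + d + d = n by omega, show n - (d + d) + d = n - d by omega,
        ← sq] at h
      exact_mod_cast h
  set μ : ℝ := J.card * q / W.card with hμ
  have hμc : 2 * c + 4 ≤ μ := by
    rw [if_pos hds] at hcon
    rw [hμ, hJ, hWc, hq, Nat.choose_symm hs, show n - s = (n - d) - (s - d) by omega,
      Nat.choose_symm (by omega)]
    exact hcon
  have hqμ : (J.card : ℝ) * q = μ * W.card := by
    rw [hμ]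
    field_simp
  have hgood : ((W.filter fun S => c < Y S).card : ℝ) < 3 / 4 * W.card := by
    unfold failProb at hfail
    rw [← hWc, div_lt_iff₀ hN] at hfail
    refine lt_of_le_of_lt ?_ hfail
    exact_mod_cast Finset.card_le_card (Finset.monotone_filter_right W fun S _ h =>
      lt_of_lt_of_le h (card_filter_disjoint_le_err A J S))
  have hsplit : ((W.filter fun S => c < Y S).card : ℝ) + (W.filter fun S => ¬ c < Y S).card =
      W.card := by
    exact_mod_cast Finset.card_filter_add_card_filter_not (s := W) fun S => c < Y S
  have hcheb : ((W.filter fun S => ¬ c < Y S).card : ℝ) * (μ / 2 + 2) ^ 2 ≤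
      μ * W.card := by
    rw [← hqμ, ← nsmul_eq_mul]
    refine (Finset.card_nsmul_le_sum _ (fun S => (Y S - μ) ^ 2) _ fun S hS => ?_).trans
      ((Finset.sum_le_sum_of_subset_of_nonneg (Finset.filter_subset _ _)
        fun _ _ _ => sq_nonneg _).trans hvar)
    have := not_lt.1 (Finset.mem_filter.1 hS).2
    nlinarith
  have hpos : 0 < (μ / 2 + 2) ^ 2 := pow_pos (by linarith) 2
  have hbad : (W.card : ℝ) / 4 < (W.filter fun S => ¬ c < Y S).card := by linarith
  have := mul_lt_mul_of_pos_right hbad hpos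
  nlinarith [mul_nonneg hN.le (sq_nonneg (μ - 4))]
end

section
/- Let ε ∈ (0, 1/4), set u = 2ε(1−2ε)/(1−4ε)² and D = ⌊1/ε⌋, and let p_k be the degree distribution P_w with these parameters. Then for every real x with 0 ≤ x ≤ 1 − ε, exp( −((1−2ε)/(1−4ε)) · Ω'(x) ) < 1 − x, where Ω'(x) = Σ_k k p_k x^{k−1}. -/
/-- The degree distribution `P_w` of the batch raptor code:
`p₁ = u/(u+1)`, `p_k = 1/(k(k−1)(u+1))` for `2 ≤ k ≤ D`, `p_{D+1} = 1/(D(u+1))`,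
and `p_k = 0` otherwise. -/
noncomputable def pw (D : ℕ) (u : ℝ) (k : ℕ) : ℝ :=
  if k = 1 then u / (u + 1)
  else if 2 ≤ k ∧ k ≤ D then 1 / ((k : ℝ) * ((k : ℝ) - 1) * (u + 1))
  else if k = D + 1 then 1 / ((D : ℝ) * (u + 1))
  else 0

theorem neg_log_one_sub_le_sum_range_add_pow {x : ℝ} (hx0 : 0 ≤ x) (hx1 : x < 1) (D : ℕ)
    (hD : x ≤ (1 - x) * (D + 1)) :
    -Real.log (1 - x) ≤ ∑ i ∈ Finset.range D, x ^ (i + 1) / ((i : ℝ) + 1) + x ^ D := by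
  have hs := Real.hasSum_pow_div_log_of_abs_lt_one (by rwa [abs_of_nonneg hx0] : |x| < 1)
  rw [← hs.tsum_eq, ← hs.summable.sum_add_tsum_nat_add D]
  gcongr
  have hg : HasSum (fun i : ℕ => x ^ (D + 1) / ((D : ℝ) + 1) * x ^ i)
      (x ^ (D + 1) / ((D : ℝ) + 1) * (1 - x)⁻¹) :=
    (hasSum_geometric_of_lt_one hx0 hx1).mul_left _
  have h1 : 0 < 1 - x := by linarith
  calc ∑' i : ℕ, x ^ (i + D + 1) / (((i + D : ℕ) : ℝ) + 1)
      ≤ x ^ (D + 1) / ((D : ℝ) + 1) * (1 - x)⁻¹ := by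
        rw [← hg.tsum_eq]
        refine ((summable_nat_add_iff D).2 hs.summable).tsum_le_tsum (fun i => ?_) hg.summable
        rw [div_mul_eq_mul_div, ← pow_add, show D + 1 + i = i + D + 1 by ring]
        gcongr
        omega
    _ = x ^ D * (x / ((1 - x) * (D + 1))) := by field_simp; ring
    _ ≤ x ^ D * 1 := by
        gcongr
        exact div_le_one_of_le₀ hD (by positivity)
    _ = x ^ D := mul_one _

theorem tsum_mul_pw_mul_pow {D : ℕ} (hD : 0 < D) {u : ℝ} (hu : 0 < u) (x : ℝ) :
    ∑' k : ℕ, (k : ℝ) * pw D u k * x ^ (k - 1) =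
      (u + (∑ i ∈ Finset.range D, x ^ (i + 1) / ((i : ℝ) + 1) + x ^ D)) / (u + 1) := by
  obtain ⟨n, rfl⟩ : ∃ n, D = n + 1 := ⟨D - 1, by omega⟩
  rw [tsum_eq_sum (s := Finset.range (n + 3))]
  · rw [Finset.sum_range_succ, Finset.sum_range_succ', Finset.sum_range_succ']
    have h : ∀ i ∈ Finset.range n,
        ((i + 1 + 1 : ℕ) : ℝ) * pw (n + 1) u (i + 1 + 1) * x ^ (i + 1 + 1 - 1) =
          x ^ (i + 1) / ((i : ℝ) + 1) / (u + 1) := by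
      intro i hi
      have hi' := Finset.mem_range.1 hi
      rw [pw, if_neg (by omega), if_pos (by omega)]
      push_cast
      rw [show (i : ℝ) + 1 + 1 - 1 = i + 1 by ring]
      field_simp
    rw [Finset.sum_congr rfl h, ← Finset.sum_div, Finset.sum_range_succ]
    have h2 : pw (n + 1) u (n + 2) = 1 / (((n : ℝ) + 1) * (u + 1)) := by
      rw [pw, if_neg (by omega), if_neg (by omega), if_pos rfl]
      push_cast
      rfl
    have h1 : pw (n + 1) u 1 = u / (u + 1) := by simp [pw]
    rw [h2, show n + 2 - 1 = n + 1 by omega]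
    simp only [zero_add, h1]
    push_cast
    field_simp
    simp
    ring
  · intro k hk
    have hk' : n + 3 ≤ k := by simpa using hk
    rw [pw, if_neg (by omega), if_neg (by omega), if_neg (by omega)]
    simp

theorem Real.log_lt_half {t : ℝ} (ht : 0 < t) : Real.log t < t / 2 := by
  have h := Real.log_le_sub_one_of_pos (half_pos ht)
  rw [Real.log_div ht.ne' two_ne_zero] at h
  linarith [Real.log_two_lt_d9]

/-- For `ε ∈ (0, 1/4)`, `u = 2ε(1−2ε)/(1−4ε)²`, `D = ⌊1/ε⌋` and `0 ≤ x ≤ 1 − ε`,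
the peeling-decoder success condition holds:
`exp(−((1−2ε)/(1−4ε)) Ω'(x)) < 1 − x`, where `Ω'(x) = Σ_k k p_k x^{k−1}`. -/
theorem stmt18 (ε : ℝ) (hε : ε ∈ Set.Ioo (0 : ℝ) (1 / 4)) (x : ℝ)
    (hx0 : 0 ≤ x) (hx1 : x ≤ 1 - ε) :
    Real.exp (-((1 - 2 * ε) / (1 - 4 * ε)) *
        ∑' k : ℕ, (k : ℝ) * pw ⌊1 / ε⌋₊ (2 * ε * (1 - 2 * ε) / (1 - 4 * ε) ^ 2) k *
          x ^ (k - 1)) <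
      1 - x := by
  obtain ⟨h0, h4⟩ := hε
  have hx : 0 < 1 - x := by linarith
  have ha : 0 < 1 - 2 * ε := by linarith
  have hb : 0 < 1 - 4 * ε := by linarith
  have hfl : 1 < ε * (⌊1 / ε⌋₊ + 1) := by
    have := Nat.lt_floor_add_one (1 / ε)
    rwa [div_lt_iff₀' h0] at this
  have hD : 0 < ⌊1 / ε⌋₊ := Nat.floor_pos.2 (by rw [le_div_iff₀ h0]; linarith)
  have hu : 0 < 2 * ε * (1 - 2 * ε) / (1 - 4 * ε) ^ 2 := by positivity
  rw [tsum_mul_pw_mul_pow hD hu, ← Real.lt_log_iff_exp_lt hx]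
  have hL := neg_log_one_sub_le_sum_range_add_pow hx0 (by linarith) ⌊1 / ε⌋₊ (by
    have : ε * ((⌊1 / ε⌋₊ : ℝ) + 1) ≤ (1 - x) * (⌊1 / ε⌋₊ + 1) := by
      gcongr
      linarith
    linarith)
  have hlog : -Real.log (1 - x) * (2 * ε) < 1 := by
    have h1 : Real.log (1 - x)⁻¹ ≤ Real.log ε⁻¹ := by
      gcongr
      linarith
    have h2 := Real.log_lt_half (inv_pos.2 h0)
    rw [Real.log_inv] at h1
    calc -Real.log (1 - x) * (2 * ε) < ε⁻¹ / 2 * (2 * ε) := by gcongr; linarith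
      _ = 1 := by field_simp
  generalize (∑ i ∈ Finset.range ⌊1 / ε⌋₊, x ^ (i + 1) / ((i : ℝ) + 1) + x ^ ⌊1 / ε⌋₊) = S at hL ⊢
  rw [neg_mul, neg_lt]
  generalize -Real.log (1 - x) = L at hL hlog ⊢
  have hq : 0 < 1 - 6 * ε + 12 * ε ^ 2 := by nlinarith
  have hsq : 1 ≤ (1 - 2 * ε) ^ 2 / (1 - 4 * ε) := by
    rw [le_div_iff₀ hb]
    nlinarith
  have heq : (1 - 2 * ε) / (1 - 4 * ε) * ((2 * ε * (1 - 2 * ε) / (1 - 4 * ε) ^ 2 + S) /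
      (2 * ε * (1 - 2 * ε) / (1 - 4 * ε) ^ 2 + 1)) =
      (2 * ε * ((1 - 2 * ε) ^ 2 / (1 - 4 * ε)) + (1 - 2 * ε) * (1 - 4 * ε) * S) /
        (1 - 6 * ε + 12 * ε ^ 2) := by
    have h1 : 2 * ε * (1 - 2 * ε) / (1 - 4 * ε) ^ 2 + 1 =
        (1 - 6 * ε + 12 * ε ^ 2) / (1 - 4 * ε) ^ 2 := by
      rw [div_add_one (pow_pos hb 2).ne']
      ring
    rw [h1]
    generalize 1 - 6 * ε + 12 * ε ^ 2 = q at hq ⊢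
    generalize 1 - 4 * ε = b at hb ⊢
    field_simp
  rw [heq, lt_div_iff₀ hq]
  have h1 := mul_le_mul_of_nonneg_left hL (mul_pos ha hb).le
  have h2 := mul_lt_mul_of_pos_left (hlog.trans_le hsq) (by positivity : 0 < 2 * ε)
  linarith
end
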